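/- Let g be a tropical polynomial in three variables with Newton polytope the dilated simplex Conv{(0,0,0),(m,0,0),(0,m,0),(0,0,m)}, and suppose C = V(max(x,y,z,0)) ∩ V(g) is a weakly smooth tropical complete intersection curve. Then the intersection of V(g) with the union of the four rays X = ℝ≥0·(−1,0,0), Y = ℝ≥0·(0,−1,0), Z = ℝ≥0·(0,0,−1), W = ℝ≥0·(1,1,1) consists of exactly m points. -/

import Mathlib

/-- A tropical polynomial in three variables: a finite set of monomial exponents
together with real coefficients.  It represents
`g(x,y,z) = max over (a,b,c) ∈ support of (coeff (a,b,c) + a·x + b·y + c·z)`. -/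
structure TropPoly3 where
  support : Finset (ℕ × ℕ × ℕ)
  coeff : ℕ × ℕ × ℕ → ℝ

namespace TropPoly3

/-- The value of the term with exponent `t` at the point `p`. -/
def val (g : TropPoly3) (t : ℕ × ℕ × ℕ) (p : ℝ × ℝ × ℝ) : ℝ :=
  g.coeff t + (t.1 : ℝ) * p.1 + (t.2.1 : ℝ) * p.2.1 + (t.2.2 : ℝ) * p.2.2

/-- The tropical hypersurface `V(g)`: the locus where the maximum among the terms of
`g` is attained at least twice. -/
def tropV (g : TropPoly3) : Set (ℝ × ℝ × ℝ) :=
  {p | ∃ t ∈ g.support, ∃ s ∈ g.support, t ≠ s ∧ g.val t p = g.val s p ∧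
        ∀ u ∈ g.support, g.val u p ≤ g.val t p}

/-- The point of the Cayley polytope in `ℝ⁴` associated to an exponent `t` on level `i`. -/
def emb (t : ℕ × ℕ × ℕ) (i : ℝ) : Fin 4 → ℝ :=
  ![(t.1 : ℝ), (t.2.1 : ℝ), (t.2.2 : ℝ), i]

/-- The lifted value of the term `t` of a polynomial placed on level `lvl`, paired
against the linear functional `p` (regular-subdivision height selection). -/
def wlift (h : TropPoly3) (t : ℕ × ℕ × ℕ) (lvl : ℝ) (p : Fin 4 → ℝ) : ℝ :=
  h.coeff t + p 0 * (t.1 : ℝ) + p 1 * (t.2.1 : ℝ) + p 2 * (t.2.2 : ℝ) + p 3 * lvl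

/-- `v` is the maximal lifted value among all terms of `f` (level 0) and `g` (level 1). -/
def IsMaxVal (f g : TropPoly3) (p : Fin 4 → ℝ) (v : ℝ) : Prop :=
  (∀ s ∈ f.support, wlift f s 0 p ≤ v) ∧ (∀ s ∈ g.support, wlift g s 1 p ≤ v)

/-- The set of Cayley points selected by the functional `p`: those lifted points of the
Cayley polytope attaining the maximal `p`-value. -/
def cayleyPts (f g : TropPoly3) (p : Fin 4 → ℝ) : Set (Fin 4 → ℝ) :=
  {x | (∃ t ∈ f.support, x = emb t 0 ∧ IsMaxVal f g p (wlift f t 0 p)) ∨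
       (∃ t ∈ g.support, x = emb t 1 ∧ IsMaxVal f g p (wlift g t 1 p))}

/-- A cell of the Cayley subdivision of `Cay(Newt f, Newt g)` associated to `f` and `g`. -/
def IsCayleyCell (f g : TropPoly3) (A : Set (Fin 4 → ℝ)) : Prop :=
  ∃ p : Fin 4 → ℝ, A = convexHull ℝ (cayleyPts f g p)

/-- A mixed cell: its intersections with both levels `0` and `1` have dimension `≥ 1`. -/
def IsMixed (A : Set (Fin 4 → ℝ)) : Prop :=
  (∃ x ∈ A, ∃ y ∈ A, x ≠ y ∧ x 3 = 0 ∧ y 3 = 0) ∧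
  (∃ x ∈ A, ∃ y ∈ A, x ≠ y ∧ x 3 = 1 ∧ y 3 = 1)

/-- `C = V(f) ∩ V(g)` is a weakly smooth tropical complete intersection curve: every
`4`-dimensional mixed cell of the Cayley subdivision has the minimal volume `1/24`. -/
def WeaklySmoothCI (f g : TropPoly3) : Prop :=
  ∀ A : Set (Fin 4 → ℝ), IsCayleyCell f g A → affineSpan ℝ A = ⊤ → IsMixed A →
    MeasureTheory.volume A = ENNReal.ofReal (1 / 24)

/-- The tropical plane polynomial `f = x ⊕ y ⊕ z ⊕ 0 = max (x, y, z, 0)`. -/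
def planePoly : TropPoly3 :=
  ⟨({(1, 0, 0), (0, 1, 0), (0, 0, 1), (0, 0, 0)} : Finset (ℕ × ℕ × ℕ)), fun _ => 0⟩

end TropPoly3

namespace TropPoly3

/-- The four rays `X, Y, Z, W` of the tropical plane `V(x ⊕ y ⊕ z ⊕ 0)`. -/
def raysXYZW : Set (ℝ × ℝ × ℝ) :=
  {p | ∃ s : ℝ, 0 ≤ s ∧ p = (-s, 0, 0)} ∪
  {p | ∃ s : ℝ, 0 ≤ s ∧ p = (0, -s, 0)} ∪
  {p | ∃ s : ℝ, 0 ≤ s ∧ p = (0, 0, -s)} ∪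
  {p | ∃ s : ℝ, 0 ≤ s ∧ p = (s, s, s)}

end TropPoly3


namespace TropPoly3
open MeasureTheory

def corner4 : Set (Fin 4 → ℝ) := {x | (∀ i, 0 ≤ x i) ∧ ∑ i, x i ≤ 1}

lemma corner4_compact : IsCompact corner4 := by
  have h : corner4 ⊆ Set.Icc (0 : Fin 4 → ℝ) 1 := by
    intro x hx
    refine ⟨fun i => hx.1 i, fun i => ?_⟩
    exact le_trans (Finset.single_le_sum (fun j _ => hx.1 j) (Finset.mem_univ i)) hx.2
  refine isCompact_Icc.of_isClosed_subset ?_ h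
  have h2 : corner4 = (⋂ i, {x : Fin 4 → ℝ | 0 ≤ x i}) ∩ {x | ∑ i, x i ≤ 1} := by
    ext x; simp [corner4]
  rw [h2]
  refine IsClosed.inter (isClosed_iInter fun i => isClosed_le continuous_const (continuous_apply i)) ?_
  exact isClosed_le (by fun_prop) continuous_const

lemma corner4_volume : ENNReal.ofReal (1 / 24) ≤ volume corner4 := by
  have hV := volume_sum_rpow_lt_one (Fin 4) (p := 1) le_rfl
  have hV' : volume {x : Fin 4 → ℝ | ∑ i, |x i| < 1} = ENNReal.ofReal (16 / 24) := by
    simp only [Real.rpow_one, Fintype.card_fin] at hV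
    rw [hV]
    norm_num
  let D : (Fin 4 → Bool) → Matrix (Fin 4) (Fin 4) ℝ := fun e =>
    Matrix.diagonal fun i => if e i then 1 else -1
  have hcov : {x : Fin 4 → ℝ | ∑ i, |x i| < 1} ⊆
      ⋃ e, (Matrix.toLin' (D e)) '' corner4 := by
    intro x hx
    rw [Set.mem_iUnion]
    refine ⟨fun i => decide (0 ≤ x i), fun i => |x i|, ⟨fun i => abs_nonneg _, hx.le⟩, ?_⟩
    ext i
    simp only [D, Matrix.toLin'_apply, Matrix.mulVec_diagonal, decide_eq_true_eq]
    split_ifs with h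
    · rw [abs_of_nonneg h]; ring
    · rw [abs_of_neg (not_le.mp h)]; ring
  have hle : volume {x : Fin 4 → ℝ | ∑ i, |x i| < 1} ≤ 16 * volume corner4 := by
    refine (measure_mono hcov).trans ((measure_iUnion_fintype_le _ _).trans ?_)
    have : ∀ e, volume ((Matrix.toLin' (D e)) '' corner4) = volume corner4 := by
      intro e
      rw [Measure.addHaar_image_linearMap, LinearMap.det_toLin', Matrix.det_diagonal,
        Finset.abs_prod]
      have : ∀ i, |(if e i then (1 : ℝ) else -1)| = 1 := by
        intro i; split_ifs <;> simp
      simp [this]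
    simp [this]
  rw [hV'] at hle
  have h16 : ENNReal.ofReal (16 / 24) = 16 * ENNReal.ofReal (1 / 24) := by
    rw [show (16 / 24 : ℝ) = 16 * (1 / 24) by norm_num, ENNReal.ofReal_mul (by norm_num)]
    norm_num
  rw [h16] at hle
  exact (ENNReal.mul_le_mul_iff_right (by norm_num) (by norm_num)).mp hle

/-- Main geometric lemma: a full-dimensional mixed cell of minimal volume is the lattice simplex. -/
lemma cell_key {f g : TropPoly3} (hws : WeaklySmoothCI f g) (p : Fin 4 → ℝ)
    (P : Fin 4 → ℝ) (Q : Fin 4 → Fin 4 → ℝ) (hP : P ∈ cayleyPts f g p)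
    (hQ : ∀ j, Q j ∈ cayleyPts f g p) (hmix : IsMixed (convexHull ℝ (cayleyPts f g p)))
    (M : Matrix (Fin 4) (Fin 4) ℝ) (hM : ∀ i j, M i j = Q j i - P i)
    (hdet : 1 ≤ |M.det|) :
    |M.det| ≤ 1 ∧ ∀ y ∈ cayleyPts f g p, ∃ x : Fin 4 → ℝ, (∀ i, 0 ≤ x i) ∧ ∑ i, x i ≤ 1 ∧
      ∀ i, y i = P i + ∑ j, M i j * x j := by
  set K := convexHull ℝ (cayleyPts f g p) with hK
  have hKc : Convex ℝ K := convex_convexHull _ _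
  have hfin : (cayleyPts f g p).Finite := by
    refine Set.Finite.subset (((f.support.finite_toSet).image (fun t => emb t 0)).union
      ((g.support.finite_toSet).image (fun t => emb t 1))) ?_
    rintro x (⟨t, ht, rfl, _⟩ | ⟨t, ht, rfl, _⟩)
    · exact Or.inl ⟨t, ht, rfl⟩
    · exact Or.inr ⟨t, ht, rfl⟩
  let S : Set (Fin 4 → ℝ) := (fun y => P + y) '' ((Matrix.toLin' M) '' corner4)
  have hSc : IsCompact S := by
    refine IsCompact.image (IsCompact.image corner4_compact ?_) (by fun_prop)
    exact LinearMap.continuous_of_finiteDimensional _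
  have hSvol : ENNReal.ofReal (|M.det|) * ENNReal.ofReal (1 / 24) ≤ volume S := by
    simp only [S]
    rw [Set.image_add_left, measure_preimage_add, Measure.addHaar_image_linearMap,
      LinearMap.det_toLin']
    gcongr
    exact corner4_volume
  have hSK : S ⊆ K := by
    rintro _ ⟨_, ⟨x, hx, rfl⟩, rfl⟩
    have h1 := (hKc.sum_mem (t := Finset.univ) (w := fun i : Option (Fin 4) =>
      i.elim (1 - ∑ j, x j) x) (z := fun i => i.elim P Q) ?_ ?_ ?_)
    · convert h1 using 1
      ext i
      simp only [Fintype.sum_option, Option.elim, Pi.add_apply, Matrix.toLin'_apply, Matrix.mulVec,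
        dotProduct, hM, Finset.sum_apply, Pi.smul_apply, smul_eq_mul, Fin.sum_univ_four]
      ring
    · rintro (_ | i) _
      · simpa using hx.2
      · exact hx.1 i
    · simp [Fintype.sum_option]
    · rintro (_ | i) _
      · exact subset_convexHull _ _ hP
      · exact subset_convexHull _ _ (hQ i)
  have hSpos : ENNReal.ofReal (1 / 24) ≤ volume S := by
    refine le_trans ?_ hSvol
    calc ENNReal.ofReal (1 / 24) = 1 * ENNReal.ofReal (1 / 24) := (one_mul _).symm
      _ ≤ _ := by gcongr; simpa using hdet
  have hint : (interior K).Nonempty := by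
    by_contra hne
    rw [Set.not_nonempty_iff_eq_empty] at hne
    have h0 := hKc.addHaar_frontier volume
    rw [frontier, hne, Set.sdiff_empty] at h0
    have h1 : volume S ≤ 0 := h0 ▸ measure_mono (hSK.trans subset_closure)
    have := hSpos.trans h1
    norm_num at this
  have hspan : affineSpan ℝ K = ⊤ := hKc.interior_nonempty_iff_affineSpan_eq_top.mp hint
  have hvol : volume K = ENNReal.ofReal (1 / 24) := hws K ⟨p, rfl⟩ hspan hmix
  constructor
  · have h2 := hSvol.trans ((measure_mono hSK).trans hvol.le)
    rw [← ENNReal.ofReal_mul (abs_nonneg _), ENNReal.ofReal_le_ofReal_iff (by norm_num)] at h2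
    linarith
  · intro y hy
    have hyS : y ∈ S := by
      by_contra hyS
      have hyK : y ∈ closure (interior K) := by
        rw [hKc.closure_interior_eq_closure_of_nonempty_interior hint]
        exact subset_closure (subset_convexHull _ _ hy)
      have hop : IsOpen Sᶜ := hSc.isClosed.isOpen_compl
      have hne : (Sᶜ ∩ interior K).Nonempty := mem_closure_iff.mp hyK _ hop hyS
      have hUpos := (hop.inter isOpen_interior).measure_pos volume hne
      have hdisj : Disjoint S (Sᶜ ∩ interior K) :=
        Set.disjoint_left.mpr fun a ha hb => hb.1 ha
      have hle : volume S + volume (Sᶜ ∩ interior K) ≤ volume K := by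
        rw [← measure_union hdisj (hop.inter isOpen_interior).measurableSet]
        exact measure_mono (Set.union_subset hSK (fun a ha => interior_subset ha.2))
      rw [hvol] at hle
      have h3 : ENNReal.ofReal (1 / 24) + volume (Sᶜ ∩ interior K) ≤ ENNReal.ofReal (1 / 24) :=
        le_trans (by gcongr) hle
      have h4 : ENNReal.ofReal (1 / 24) < ENNReal.ofReal (1 / 24) + volume (Sᶜ ∩ interior K) :=
        ENNReal.lt_add_right ENNReal.ofReal_ne_top hUpos.ne'
      exact absurd h3 (not_le.mpr h4)
    obtain ⟨_, ⟨x, hx, rfl⟩, rfl⟩ := hyS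
    refine ⟨x, hx.1, hx.2, fun i => ?_⟩
    simp [Matrix.mulVec, dotProduct]

end TropPoly3

namespace TropPoly3

/-- Counting breakpoints of a one-variable tropical polynomial. -/
lemma count_breaks {α : Type*} (supp : Finset α) (c : α → ℝ) (u : α → ℤ) (N : ℤ)
    (hN : ∀ t ∈ supp, u t ≤ N) (hex : ∃ t ∈ supp, u t = N)
    (A : ℝ → α → Prop) (hA : ∀ s t, A s t ↔ t ∈ supp ∧ ∀ t' ∈ supp, c t' + s * u t' ≤ c t + s * u t)
    (h : ∀ s > 0, ∀ t t', A s t → A s t' → u t ≠ u t' → |u t - u t'| ≤ 1 ∧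
      ∀ t'', A s t'' → u t'' = u t → t'' = t) :
    ∀ (n : ℕ) (s : ℝ) (t : α), 0 ≤ s → A s t → (∀ t', A s t' → t' ≠ t → u t' < u t) →
      N - u t = n → {r : ℝ | s < r ∧ ∃ t t', t ≠ t' ∧ A r t ∧ A r t'}.encard = n := by
  have hnext : ∀ s t r t', A s t → (∀ t', A s t' → t' ≠ t → u t' < u t) → s < r →
      (∀ t' ∈ supp, u t < u t' → c t' + r * u t' < c t + r * u t) → A r t' → t' = t := by
    intro s t r t' hst hun hsr hgt hrt'
    by_contra hne
    obtain ⟨ht, hmax⟩ := (hA s t).mp hst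
    obtain ⟨ht', hmax'⟩ := (hA r t').mp hrt'
    have h1 := hmax' t ht
    have h2 := hmax t' ht'
    rcases lt_trichotomy (u t') (u t) with hlt | heq | hlt
    · have : (u t' : ℝ) < u t := by exact_mod_cast hlt
      nlinarith
    · rw [heq] at h1 h2
      have hA' : A s t' := (hA s t').mpr ⟨ht', fun t'' ht'' => by
        have := hmax t'' ht''
        rw [heq]; linarith⟩
      have := hun t' hA' hne
      omega
    · have := hgt t' ht' hlt
      linarith
  intro n
  induction n with
  | zero =>
    intro s t hs hst hun hn
    rw [Nat.cast_zero, Set.encard_eq_zero, Set.eq_empty_iff_forall_notMem]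
    rintro r ⟨hsr, t1, t2, hne, h1, h2⟩
    have hgt : ∀ t' ∈ supp, u t < u t' → c t' + r * u t' < c t + r * u t := by
      intro t' ht' hlt
      have := hN t' ht'
      simp at hn
      omega
    exact hne ((hnext s t r t1 hst hun hsr hgt h1).trans (hnext s t r t2 hst hun hsr hgt h2).symm)
  | succ n ih =>
    intro s t hs hst hun hn
    obtain ⟨ht, hmax⟩ := (hA s t).mp hst
    classical
    let B := supp.filter (fun t' => u t < u t')
    have hB : B.Nonempty := by
      obtain ⟨t', ht', hu⟩ := hex
      refine ⟨t', Finset.mem_filter.mpr ⟨ht', ?_⟩⟩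
      push_cast at hn
      omega
    obtain ⟨t', ht'B, hmin⟩ := B.exists_min_image (fun t' => (c t - c t') / (u t' - u t : ℝ)) hB
    obtain ⟨ht', hut'⟩ := Finset.mem_filter.mp ht'B
    set r := (c t - c t') / (u t' - u t : ℝ) with hr
    have hut'R : (0 : ℝ) < u t' - u t := by
      have : (u t : ℝ) < u t' := by exact_mod_cast hut'
      linarith
    have hreq : c t' + r * u t' = c t + r * u t := by
      have : r * (u t' - u t : ℝ) = c t - c t' := by rw [hr]; field_simp
      linarith
    have hsr : s < r := by
      have h1 := hmax t' ht'
      by_contra hle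
      push Not at hle
      have heq : c t' + s * u t' = c t + s * u t := by nlinarith
      have hA' : A s t' := (hA s t').mpr ⟨ht', fun t'' ht'' => by rw [heq]; exact hmax t'' ht''⟩
      have := hun t' hA' (by rintro rfl; omega)
      omega
    have hle_r : ∀ t'' ∈ supp, u t < u t'' → ∀ q, q ≤ r → (q < r → c t'' + q * u t'' < c t + q * u t) ∧
        c t'' + q * u t'' ≤ c t + q * u t := by
      intro t'' ht'' hlt q hq
      have h1 : r ≤ _ := hmin t'' (Finset.mem_filter.mpr ⟨ht'', hlt⟩)
      have hpos : (0 : ℝ) < u t'' - u t := by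
        have : (u t : ℝ) < u t'' := by exact_mod_cast hlt
        linarith
      rw [le_div_iff₀ hpos] at h1
      constructor
      · intro hq
        nlinarith
      · nlinarith
    have hArt : A r t := by
      refine (hA r t).mpr ⟨ht, fun t'' ht'' => ?_⟩
      by_cases hlt : u t < u t''
      · exact (hle_r t'' ht'' hlt r le_rfl).2
      · have h1 := hmax t'' ht''
        have : (u t'' : ℝ) ≤ u t := by exact_mod_cast not_lt.mp hlt
        nlinarith
    have hArt' : A r t' := by
      refine (hA r t').mpr ⟨ht', fun t'' ht'' => ?_⟩
      rw [hreq]; exact ((hA r t).mp hArt).2 t'' ht''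
    have hr0 : 0 < r := lt_of_le_of_lt hs hsr
    obtain ⟨hd, _⟩ := h r hr0 t t' hArt hArt' hut'.ne
    have hd' : u t' = u t + 1 := by
      rw [abs_le] at hd; omega
    have hun' : ∀ t'', A r t'' → t'' ≠ t' → u t'' < u t' := by
      intro t'' hA'' hne
      have hne' : u t'' ≠ u t' := fun heq =>
        hne ((h r hr0 t' t hArt' hArt hut'.ne').2 t'' hA'' heq)
      by_cases heq : u t'' = u t
      · omega
      · have := (h r hr0 t'' t hA'' hArt heq).1
        rw [abs_le] at this
        omega
    have hrec := ih r t' hr0.le hArt' hun' (by push_cast at hn; omega)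
    have hset : {q : ℝ | s < q ∧ ∃ t t', t ≠ t' ∧ A q t ∧ A q t'} =
        insert r {q : ℝ | r < q ∧ ∃ t t', t ≠ t' ∧ A q t ∧ A q t'} := by
      ext q
      simp only [Set.mem_ofPred_eq, Set.mem_insert_iff]
      constructor
      · rintro ⟨hsq, t1, t2, hne, h1, h2⟩
        rcases lt_trichotomy q r with hlt | heq | hlt
        · exfalso
          have hgt : ∀ t' ∈ supp, u t < u t' → c t' + q * u t' < c t + q * u t :=
            fun t3 ht3 hlt3 => (hle_r t3 ht3 hlt3 q hlt.le).1 hlt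
          exact hne ((hnext s t q t1 hst hun hsq hgt h1).trans
            (hnext s t q t2 hst hun hsq hgt h2).symm)
        · exact Or.inl heq
        · exact Or.inr ⟨hlt, t1, t2, hne, h1, h2⟩
      · rintro (rfl | ⟨hlt, hx⟩)
        · exact ⟨hsr, t, t', by rintro rfl; omega, hArt, hArt'⟩
        · exact ⟨hsr.trans hlt, hx⟩
    rw [hset, Set.encard_insert_of_notMem (by simp), hrec]
    push_cast
    rfl

end TropPoly3

namespace TropPoly3

/-- `t` attains the maximum of `g` at `x`. -/
def Top (g : TropPoly3) (x : ℝ × ℝ × ℝ) (t : ℕ × ℕ × ℕ) : Prop :=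
  t ∈ g.support ∧ ∀ u ∈ g.support, g.val u x ≤ g.val t x

lemma mem_tropV_iff (g : TropPoly3) (x : ℝ × ℝ × ℝ) :
    x ∈ tropV g ↔ ∃ t t', t ≠ t' ∧ g.Top x t ∧ g.Top x t' := by
  constructor
  · rintro ⟨t, ht, s, hs, hne, heq, hmax⟩
    exact ⟨t, s, hne, ⟨ht, hmax⟩, ⟨hs, fun u hu => heq ▸ hmax u hu⟩⟩
  · rintro ⟨t, s, hne, ht, hs⟩
    exact ⟨t, ht.1, s, hs.1, hne, le_antisymm (hs.2 t ht.1) (ht.2 s hs.1), ht.2⟩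

lemma emb_inj {t s : ℕ × ℕ × ℕ} {i j : ℝ} (h : emb t i = emb s j) : t = s := by
  have h0 := congrFun h 0
  have h1 := congrFun h 1
  have h2 := congrFun h 2
  simp only [emb, Matrix.cons_val] at h0 h1 h2
  ext
  · exact_mod_cast h0
  · exact_mod_cast h1
  · exact_mod_cast h2

/-- The functional selecting the Cayley cell over the point `x`. -/
def cellFun (x : ℝ × ℝ × ℝ) (l : ℝ) : Fin 4 → ℝ := ![x.1, x.2.1, x.2.2, l]

lemma wlift_plane (e : ℕ × ℕ × ℕ) (x : ℝ × ℝ × ℝ) (l : ℝ) :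
    wlift planePoly e 0 (cellFun x l) = planePoly.val e x := by
  simp [wlift, cellFun, planePoly, val]; ring

lemma wlift_g (g : TropPoly3) (t : ℕ × ℕ × ℕ) (x : ℝ × ℝ × ℝ) (l : ℝ) :
    wlift g t 1 (cellFun x l) = g.val t x + l := by
  simp [wlift, cellFun, val]; ring

lemma mem_cell_f (g : TropPoly3) (x : ℝ × ℝ × ℝ) (e e' t : ℕ × ℕ × ℕ)
    (he : planePoly.Top x e) (he' : planePoly.Top x e') (ht : g.Top x t) :
    emb e' 0 ∈ cayleyPts planePoly g (cellFun x (planePoly.val e x - g.val t x)) := by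
  refine Or.inl ⟨e', he'.1, rfl, fun s hs => ?_, fun s hs => ?_⟩
  · rw [wlift_plane, wlift_plane]; exact he'.2 s hs
  · rw [wlift_plane, wlift_g]
    have := ht.2 s hs
    have := he'.2 e he.1
    linarith

lemma mem_cell_g (g : TropPoly3) (x : ℝ × ℝ × ℝ) (e t t' : ℕ × ℕ × ℕ)
    (he : planePoly.Top x e) (ht : g.Top x t) (ht' : g.Top x t') :
    emb t' 1 ∈ cayleyPts planePoly g (cellFun x (planePoly.val e x - g.val t x)) := by
  refine Or.inr ⟨t', ht'.1, rfl, fun s hs => ?_, fun s hs => ?_⟩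
  · rw [wlift_plane, wlift_g]
    have := ht'.2 t ht.1
    have := he.2 s hs
    linarith
  · rw [wlift_g, wlift_g]
    have := ht'.2 s hs
    linarith

lemma mixed_of (f g : TropPoly3) (p : Fin 4 → ℝ) (e e' t t' : ℕ × ℕ × ℕ) (hee : e ≠ e')
    (htt : t ≠ t') (h1 : emb e 0 ∈ cayleyPts f g p) (h2 : emb e' 0 ∈ cayleyPts f g p)
    (h3 : emb t 1 ∈ cayleyPts f g p) (h4 : emb t' 1 ∈ cayleyPts f g p) :
    IsMixed (convexHull ℝ (cayleyPts f g p)) := by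
  refine ⟨⟨_, subset_convexHull _ _ h1, _, subset_convexHull _ _ h2, fun h => hee (emb_inj h),
    ?_, ?_⟩, ⟨_, subset_convexHull _ _ h3, _, subset_convexHull _ _ h4, fun h => htt (emb_inj h),
    ?_, ?_⟩⟩ <;> simp [emb]

lemma top_origin (e : ℕ × ℕ × ℕ) (he : e ∈ planePoly.support) : planePoly.Top (0, 0, 0) e := by
  refine ⟨he, fun u _ => ?_⟩
  simp [val, planePoly]

/-- The origin is not on `V(g)`. -/
lemma origin_unique {g : TropPoly3} (hws : WeaklySmoothCI planePoly g) (t t' : ℕ × ℕ × ℕ)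
    (ht : g.Top (0, 0, 0) t) (ht' : g.Top (0, 0, 0) t') : t' = t := by
  by_contra hne
  have h0 := top_origin (0, 0, 0) (by simp [planePoly])
  have h1 := top_origin (1, 0, 0) (by simp [planePoly])
  have h2 := top_origin (0, 1, 0) (by simp [planePoly])
  have h3 := top_origin (0, 0, 1) (by simp [planePoly])
  have k0 := mem_cell_f g _ _ _ t h0 h0 ht
  have k1 := mem_cell_f g _ _ _ t h0 h1 ht
  have k2 := mem_cell_f g _ _ _ t h0 h2 ht
  have k3 := mem_cell_f g _ _ _ t h0 h3 ht
  have k4 := mem_cell_g g _ _ _ _ h0 ht ht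
  have k5 := mem_cell_g g _ _ _ _ h0 ht ht'
  have hmix := mixed_of _ _ _ _ _ _ _ (by simp) hne k0 k1 k5 k4
  have key := cell_key hws _ (emb (0, 0, 0) 0) ![emb (1, 0, 0) 0, emb (0, 1, 0) 0,
    emb (0, 0, 1) 0, emb t 1] k0 (by
      intro j; fin_cases j
      · exact k1
      · exact k2
      · exact k3
      · exact k4) hmix
    !![1, 0, 0, (t.1 : ℝ); 0, 1, 0, (t.2.1 : ℝ); 0, 0, 1, (t.2.2 : ℝ); 0, 0, 0, 1]
    (by intro i j; fin_cases i <;> fin_cases j <;> simp [emb])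
    (by simp [Matrix.det_succ_row_zero, Fin.sum_univ_succ, Fin.succAbove])
  obtain ⟨x, hx0, hx1, hx⟩ := key.2 _ k5
  have e0 := hx 0
  have e1 := hx 1
  have e2 := hx 2
  have e3 := hx 3
  simp [emb, Fin.sum_univ_four] at e0 e1 e2 e3
  rw [Fin.sum_univ_four] at hx1
  have x0 := hx0 0
  have x1 := hx0 1
  have x2 := hx0 2
  rw [← e3] at e0 e1 e2 hx1
  apply hne
  ext
  · have : (t'.1 : ℝ) = t.1 := by linarith
    exact_mod_cast this
  · have : (t'.2.1 : ℝ) = t.2.1 := by linarith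
    exact_mod_cast this
  · have : (t'.2.2 : ℝ) = t.2.2 := by linarith
    exact_mod_cast this

/-- Pairing of an exponent with an integer direction. -/
def pair (v : ℤ × ℤ × ℤ) (t : ℕ × ℕ × ℕ) : ℤ := v.1 * t.1 + v.2.1 * t.2.1 + v.2.2 * t.2.2

def rayPt (v : ℤ × ℤ × ℤ) (s : ℝ) : ℝ × ℝ × ℝ := (s * v.1, s * v.2.1, s * v.2.2)

lemma val_rayPt (g : TropPoly3) (v : ℤ × ℤ × ℤ) (s : ℝ) (t : ℕ × ℕ × ℕ) :
    g.val t (rayPt v s) = g.coeff t + s * (pair v t : ℤ) := by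
  simp [val, rayPt, pair]; ring

def simplexMat (e0 e1 e2 t t' : ℕ × ℕ × ℕ) : Matrix (Fin 4) (Fin 4) ℝ :=
  !![(e1.1 : ℝ) - e0.1, (e2.1 : ℝ) - e0.1, (t.1 : ℝ) - e0.1, (t'.1 : ℝ) - e0.1;
     (e1.2.1 : ℝ) - e0.2.1, (e2.2.1 : ℝ) - e0.2.1, (t.2.1 : ℝ) - e0.2.1, (t'.2.1 : ℝ) - e0.2.1;
     (e1.2.2 : ℝ) - e0.2.2, (e2.2.2 : ℝ) - e0.2.2, (t.2.2 : ℝ) - e0.2.2, (t'.2.2 : ℝ) - e0.2.2;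
     0, 0, 1, 1]

structure GoodRay (v : ℤ × ℤ × ℤ) (e0 e1 e2 : ℕ × ℕ × ℕ) : Prop where
  top0 : ∀ s > 0, planePoly.Top (rayPt v s) e0
  top1 : ∀ s > 0, planePoly.Top (rayPt v s) e1
  top2 : ∀ s > 0, planePoly.Top (rayPt v s) e2
  ne : e0 ≠ e1
  det : ∀ t t', |(simplexMat e0 e1 e2 t t').det| = |((pair v t - pair v t' : ℤ) : ℝ)|

lemma ray_local {g : TropPoly3} (hws : WeaklySmoothCI planePoly g) {v : ℤ × ℤ × ℤ}
    {e0 e1 e2 : ℕ × ℕ × ℕ} (hr : GoodRay v e0 e1 e2) (s : ℝ) (hs : 0 < s) (t t' : ℕ × ℕ × ℕ)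
    (ht : g.Top (rayPt v s) t) (ht' : g.Top (rayPt v s) t') (hne : pair v t ≠ pair v t') :
    |pair v t - pair v t'| ≤ 1 ∧
      ∀ t'', g.Top (rayPt v s) t'' → pair v t'' = pair v t → t'' = t := by
  have h0 := hr.top0 s hs
  have k0 := mem_cell_f g _ _ _ t h0 h0 ht
  have k1 := mem_cell_f g _ _ _ t h0 (hr.top1 s hs) ht
  have k2 := mem_cell_f g _ _ _ t h0 (hr.top2 s hs) ht
  have k3 := mem_cell_g g _ _ _ _ h0 ht ht
  have k4 := mem_cell_g g _ _ _ _ h0 ht ht'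
  have hmix := mixed_of _ _ _ _ _ _ _ hr.ne (fun h => hne (by rw [h])) k0 k1 k3 k4
  have key := cell_key hws _ (emb e0 0) ![emb e1 0, emb e2 0, emb t 1, emb t' 1] k0 (by
      intro j; fin_cases j
      · exact k1
      · exact k2
      · exact k3
      · exact k4) hmix (simplexMat e0 e1 e2 t t')
    (by intro i j; fin_cases i <;> fin_cases j <;> simp [emb, simplexMat])
    (by
      rw [hr.det]
      have := Int.one_le_abs (sub_ne_zero.mpr hne)
      exact_mod_cast this)
  constructor
  · have := key.1
    rw [hr.det] at this
    exact_mod_cast this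
  · intro t'' ht'' heq
    obtain ⟨x, hx0, hx1, hx⟩ := key.2 _ (mem_cell_g g _ _ _ _ h0 ht ht'')
    have a0 := hx 0
    have a1 := hx 1
    have a2 := hx 2
    have a3 := hx 3
    simp [emb, Fin.sum_univ_four, simplexMat] at a0 a1 a2 a3
    rw [Fin.sum_univ_four] at hx1
    have x0 : x 0 = 0 := by linarith [hx0 0, hx0 1]
    have x1 : x 1 = 0 := by linarith [hx0 0, hx0 1]
    have x2 : x 2 = 1 - x 3 := by linarith
    rw [x0, x1, x2] at a0 a1 a2
    have heqR : ((pair v t'' : ℤ) : ℝ) = (pair v t : ℤ) := by rw [heq]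
    have hneR : ((pair v t' : ℤ) : ℝ) - (pair v t : ℤ) ≠ 0 := by
      rw [sub_ne_zero]; exact_mod_cast hne.symm
    have hz : x 3 * (((pair v t' : ℤ) : ℝ) - (pair v t : ℤ)) = 0 := by
      simp only [pair] at heqR ⊢
      push_cast at heqR ⊢
      rw [a0, a1, a2] at heqR
      linarith
    have x3 : x 3 = 0 := (mul_eq_zero.mp hz).resolve_right hneR
    rw [x3] at a0 a1 a2
    ext
    · have : (t''.1 : ℝ) = t.1 := by linarith
      exact_mod_cast this
    · have : (t''.2.1 : ℝ) = t.2.1 := by linarith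
      exact_mod_cast this
    · have : (t''.2.2 : ℝ) = t.2.2 := by linarith
      exact_mod_cast this

lemma ray_count {g : TropPoly3} (hws : WeaklySmoothCI planePoly g) {v : ℤ × ℤ × ℤ}
    {e0 e1 e2 : ℕ × ℕ × ℕ} (hr : GoodRay v e0 e1 e2) (t0 : ℕ × ℕ × ℕ)
    (ht0 : g.Top (0, 0, 0) t0) (N : ℤ) (hN : ∀ t ∈ g.support, pair v t ≤ N)
    (hex : ∃ t ∈ g.support, pair v t = N) (n : ℕ) (hn : N - pair v t0 = n) :
    {s : ℝ | 0 < s ∧ rayPt v s ∈ tropV g}.encard = n := by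
  have hz : rayPt v 0 = (0, 0, 0) := by simp [rayPt]
  have := count_breaks g.support g.coeff (pair v) N hN hex (fun s t => g.Top (rayPt v s) t)
    (fun s t => by simp only [Top, val_rayPt]) (fun s hs t t' => ray_local hws hr s hs t t')
    n 0 t0 le_rfl (by rw [hz]; exact ht0)
    (fun t' ht' hne => absurd (origin_unique hws t0 t' ht0 (by rwa [hz] at ht')) hne) hn
  simp only [mem_tropV_iff]
  exact this

lemma goodX : GoodRay (-1, 0, 0) (0, 0, 0) (0, 1, 0) (0, 0, 1) where
  top0 := fun s hs => ⟨by simp [planePoly], fun u hu => by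
    simp only [planePoly, Finset.mem_insert, Finset.mem_singleton] at hu
    rcases hu with rfl | rfl | rfl | rfl <;> simp [val, planePoly, rayPt] <;> linarith⟩
  top1 := fun s hs => ⟨by simp [planePoly], fun u hu => by
    simp only [planePoly, Finset.mem_insert, Finset.mem_singleton] at hu
    rcases hu with rfl | rfl | rfl | rfl <;> simp [val, planePoly, rayPt] <;> linarith⟩
  top2 := fun s hs => ⟨by simp [planePoly], fun u hu => by
    simp only [planePoly, Finset.mem_insert, Finset.mem_singleton] at hu
    rcases hu with rfl | rfl | rfl | rfl <;> simp [val, planePoly, rayPt] <;> linarith⟩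
  ne := by simp
  det := fun t t' => by
    rw [abs_eq_abs]
    simp [simplexMat, pair, Matrix.det_succ_row_zero, Fin.sum_univ_succ, Fin.succAbove]
    all_goals first | (left; ring; done) | (right; ring; done)

lemma goodY : GoodRay (0, -1, 0) (0, 0, 0) (1, 0, 0) (0, 0, 1) where
  top0 := fun s hs => ⟨by simp [planePoly], fun u hu => by
    simp only [planePoly, Finset.mem_insert, Finset.mem_singleton] at hu
    rcases hu with rfl | rfl | rfl | rfl <;> simp [val, planePoly, rayPt] <;> linarith⟩
  top1 := fun s hs => ⟨by simp [planePoly], fun u hu => by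
    simp only [planePoly, Finset.mem_insert, Finset.mem_singleton] at hu
    rcases hu with rfl | rfl | rfl | rfl <;> simp [val, planePoly, rayPt] <;> linarith⟩
  top2 := fun s hs => ⟨by simp [planePoly], fun u hu => by
    simp only [planePoly, Finset.mem_insert, Finset.mem_singleton] at hu
    rcases hu with rfl | rfl | rfl | rfl <;> simp [val, planePoly, rayPt] <;> linarith⟩
  ne := by simp
  det := fun t t' => by
    rw [abs_eq_abs]
    simp [simplexMat, pair, Matrix.det_succ_row_zero, Fin.sum_univ_succ, Fin.succAbove]
    all_goals first | (left; ring; done) | (right; ring; done)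

lemma goodZ : GoodRay (0, 0, -1) (0, 0, 0) (1, 0, 0) (0, 1, 0) where
  top0 := fun s hs => ⟨by simp [planePoly], fun u hu => by
    simp only [planePoly, Finset.mem_insert, Finset.mem_singleton] at hu
    rcases hu with rfl | rfl | rfl | rfl <;> simp [val, planePoly, rayPt] <;> linarith⟩
  top1 := fun s hs => ⟨by simp [planePoly], fun u hu => by
    simp only [planePoly, Finset.mem_insert, Finset.mem_singleton] at hu
    rcases hu with rfl | rfl | rfl | rfl <;> simp [val, planePoly, rayPt] <;> linarith⟩
  top2 := fun s hs => ⟨by simp [planePoly], fun u hu => by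
    simp only [planePoly, Finset.mem_insert, Finset.mem_singleton] at hu
    rcases hu with rfl | rfl | rfl | rfl <;> simp [val, planePoly, rayPt] <;> linarith⟩
  ne := by simp
  det := fun t t' => by
    rw [abs_eq_abs]
    simp [simplexMat, pair, Matrix.det_succ_row_zero, Fin.sum_univ_succ, Fin.succAbove]
    all_goals first | (left; ring; done) | (right; ring; done)

lemma goodW : GoodRay (1, 1, 1) (1, 0, 0) (0, 1, 0) (0, 0, 1) where
  top0 := fun s hs => ⟨by simp [planePoly], fun u hu => by
    simp only [planePoly, Finset.mem_insert, Finset.mem_singleton] at hu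
    rcases hu with rfl | rfl | rfl | rfl <;> simp [val, planePoly, rayPt] <;> linarith⟩
  top1 := fun s hs => ⟨by simp [planePoly], fun u hu => by
    simp only [planePoly, Finset.mem_insert, Finset.mem_singleton] at hu
    rcases hu with rfl | rfl | rfl | rfl <;> simp [val, planePoly, rayPt] <;> linarith⟩
  top2 := fun s hs => ⟨by simp [planePoly], fun u hu => by
    simp only [planePoly, Finset.mem_insert, Finset.mem_singleton] at hu
    rcases hu with rfl | rfl | rfl | rfl <;> simp [val, planePoly, rayPt] <;> linarith⟩
  ne := by simp
  det := fun t t' => by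
    rw [abs_eq_abs]
    simp [simplexMat, pair, Matrix.det_succ_row_zero, Fin.sum_univ_succ, Fin.succAbove]
    all_goals first | (left; ring; done) | (right; ring; done)

lemma newt_min (S : Finset (ℕ × ℕ × ℕ)) (T : Set (ℝ × ℝ × ℝ))
    (h : convexHull ℝ ((fun t : ℕ × ℕ × ℕ => (((t.1 : ℝ), (t.2.1 : ℝ), (t.2.2 : ℝ)) : ℝ × ℝ × ℝ)) ''
          (S : Set (ℕ × ℕ × ℕ))) = convexHull ℝ T) (v : ℤ × ℤ × ℤ) (N : ℤ)
    (hle : ∀ y ∈ T, (v.1 : ℝ) * y.1 + v.2.1 * y.2.1 + v.2.2 * y.2.2 ≤ N)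
    (y : ℝ × ℝ × ℝ) (hy : y ∈ T) (hge : (v.1 : ℝ) * y.1 + v.2.1 * y.2.1 + v.2.2 * y.2.2 = N) :
    (∀ t ∈ S, pair v t ≤ N) ∧ ∃ t ∈ S, pair v t = N := by
  have hconv : ∀ c : ℝ, Convex ℝ {y : ℝ × ℝ × ℝ |
      (v.1 : ℝ) * y.1 + v.2.1 * y.2.1 + v.2.2 * y.2.2 ≤ c} := by
    intro c x hx z hz a b ha hb hab
    simp only [Set.mem_ofPred_eq, Prod.fst_add, Prod.snd_add, Prod.smul_fst, Prod.smul_snd,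
      smul_eq_mul] at hx hz ⊢
    have hc : c = a * c + b * c := by rw [← add_mul, hab, one_mul]
    rw [hc]
    have := mul_le_mul_of_nonneg_left hx ha
    have := mul_le_mul_of_nonneg_left hz hb
    linarith
  have hle' : ∀ t ∈ S, pair v t ≤ N := by
    intro t ht
    have h1 : (((t.1 : ℝ), (t.2.1 : ℝ), (t.2.2 : ℝ)) : ℝ × ℝ × ℝ) ∈ convexHull ℝ T := by
      rw [← h]
      exact subset_convexHull _ _ ⟨t, ht, rfl⟩
    have h2 : (v.1 : ℝ) * (t.1 : ℝ) + v.2.1 * (t.2.1 : ℝ) + v.2.2 * (t.2.2 : ℝ) ≤ N :=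
      convexHull_min (t := {y : ℝ × ℝ × ℝ |
        (v.1 : ℝ) * y.1 + v.2.1 * y.2.1 + v.2.2 * y.2.2 ≤ N}) (fun y hy => hle y hy) (hconv N) h1
    simp only [pair]
    exact_mod_cast h2
  refine ⟨hle', ?_⟩
  by_contra hno
  push Not at hno
  have h1 : y ∈ convexHull ℝ T := subset_convexHull _ _ hy
  rw [← h] at h1
  have h2 := convexHull_min (t := {y : ℝ × ℝ × ℝ |
      (v.1 : ℝ) * y.1 + v.2.1 * y.2.1 + v.2.2 * y.2.2 ≤ ((N - 1 : ℤ) : ℝ)}) (by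
    rintro _ ⟨t, ht, rfl⟩
    have h3 : pair v t ≤ N - 1 := by
      have := lt_of_le_of_ne (hle' t ht) (hno t ht)
      omega
    simp only [Set.mem_ofPred_eq]
    simp only [pair] at h3
    exact_mod_cast h3) (hconv _) h1
  simp only [Set.mem_ofPred_eq] at h2
  rw [hge] at h2
  push_cast at h2
  linarith

lemma rayPt_inj {v : ℤ × ℤ × ℤ} (hv : v ≠ 0) : Function.Injective (rayPt v) := by
  intro s r h
  simp only [rayPt, Prod.mk.injEq] at h
  obtain ⟨h1, h2, h3⟩ := h
  by_contra hne
  apply hv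
  have key : ∀ k : ℤ, s * (k : ℝ) = r * k → k = 0 := by
    intro k hk
    by_contra hk0
    exact hne (mul_right_cancel₀ (by exact_mod_cast hk0) hk)
  ext
  · exact key _ h1
  · exact key _ h2
  · exact key _ h3

end TropPoly3

open TropPoly3 in
/-- Lemma 4.3 of the paper: if `g` has Newton polytope the dilated simplex
`Conv{(0,0,0),(m,0,0),(0,m,0),(0,0,m)}` and `C = V(x ⊕ y ⊕ z ⊕ 0) ∩ V(g)` is a
weakly smooth tropical complete intersection curve, then `V(g)` meets the union of
the four rays `X ∪ Y ∪ Z ∪ W` in exactly `m` points. -/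
theorem tropV_meets_rays_in_m_points (m : ℕ) (hm : 0 < m) (g : TropPoly3)
    (hNewt : convexHull ℝ
        ((fun t : ℕ × ℕ × ℕ => (((t.1 : ℝ), (t.2.1 : ℝ), (t.2.2 : ℝ)) : ℝ × ℝ × ℝ)) ''
          (g.support : Set (ℕ × ℕ × ℕ))) =
      convexHull ℝ ({((0 : ℝ), (0 : ℝ), (0 : ℝ)), ((m : ℝ), 0, 0), (0, (m : ℝ), 0),
        (0, 0, (m : ℝ))} : Set (ℝ × ℝ × ℝ)))
    (hws : WeaklySmoothCI planePoly g) :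
    (tropV g ∩ raysXYZW).Finite ∧ (tropV g ∩ raysXYZW).ncard = m := by
  classical
  have hT := hNewt
  obtain ⟨Xle, Xex⟩ := newt_min _ _ hNewt (-1, 0, 0) 0 (by
    rintro y (rfl | rfl | rfl | rfl) <;> simp) (0, 0, 0) (by simp) (by simp)
  obtain ⟨Yle, Yex⟩ := newt_min _ _ hNewt (0, -1, 0) 0 (by
    rintro y (rfl | rfl | rfl | rfl) <;> simp) (0, 0, 0) (by simp) (by simp)
  obtain ⟨Zle, Zex⟩ := newt_min _ _ hNewt (0, 0, -1) 0 (by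
    rintro y (rfl | rfl | rfl | rfl) <;> simp) (0, 0, 0) (by simp) (by simp)
  obtain ⟨Wle, Wex⟩ := newt_min _ _ hNewt (1, 1, 1) m (by
    rintro y (rfl | rfl | rfl | rfl) <;> simp) ((m : ℝ), 0, 0) (by simp) (by simp)
  have hne : g.support.Nonempty := by
    obtain ⟨t, ht, _⟩ := Xex
    exact ⟨t, ht⟩
  obtain ⟨t0, ht0, hmax⟩ := g.support.exists_max_image (fun t => g.val t (0, 0, 0)) hne
  have htop : g.Top (0, 0, 0) t0 := ⟨ht0, hmax⟩
  have hW0 := Wle t0 ht0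
  simp only [pair] at hW0
  obtain ⟨d, hd⟩ : ∃ d : ℕ, t0.1 + t0.2.1 + t0.2.2 + d = m :=
    ⟨m - (t0.1 + t0.2.1 + t0.2.2), by omega⟩
  have cX := ray_count hws goodX t0 htop 0 Xle Xex t0.1 (by simp [pair])
  have cY := ray_count hws goodY t0 htop 0 Yle Yex t0.2.1 (by simp [pair])
  have cZ := ray_count hws goodZ t0 htop 0 Zle Zex t0.2.2 (by simp [pair])
  have cW := ray_count hws goodW t0 htop m Wle Wex d (by simp only [pair]; omega)
  have h0 : ((0 : ℝ), (0 : ℝ), (0 : ℝ)) ∉ tropV g := by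
    rw [mem_tropV_iff]
    rintro ⟨t, t', hn, h1, h2⟩
    exact hn (origin_unique hws _ _ h2 h1)
  set SX := {s : ℝ | 0 < s ∧ rayPt (-1, 0, 0) s ∈ tropV g} with hSX
  set SY := {s : ℝ | 0 < s ∧ rayPt (0, -1, 0) s ∈ tropV g} with hSY
  set SZ := {s : ℝ | 0 < s ∧ rayPt (0, 0, -1) s ∈ tropV g} with hSZ
  set SW := {s : ℝ | 0 < s ∧ rayPt (1, 1, 1) s ∈ tropV g} with hSW
  have hset : tropV g ∩ raysXYZW = ((rayPt (-1, 0, 0) '' SX ∪ rayPt (0, -1, 0) '' SY) ∪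
      rayPt (0, 0, -1) '' SZ) ∪ rayPt (1, 1, 1) '' SW := by
    have hpos : ∀ s : ℝ, 0 ≤ s → ∀ v, rayPt v s ∈ tropV g → 0 < s := by
      intro s hs v hv
      rcases hs.lt_or_eq with h | h
      · exact h
      · exfalso; apply h0; rw [← h] at hv; simpa [rayPt] using hv
    have eX : ∀ s, rayPt (-1, 0, 0) s = (-s, 0, 0) := fun s => by simp [rayPt]
    have eY : ∀ s, rayPt (0, -1, 0) s = (0, -s, 0) := fun s => by simp [rayPt]
    have eZ : ∀ s, rayPt (0, 0, -1) s = (0, 0, -s) := fun s => by simp [rayPt]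
    have eW : ∀ s, rayPt (1, 1, 1) s = (s, s, s) := fun s => by simp [rayPt]
    ext p
    constructor
    · rintro ⟨hp, ((⟨s, hs, rfl⟩ | ⟨s, hs, rfl⟩) | ⟨s, hs, rfl⟩) | ⟨s, hs, rfl⟩⟩
      · rw [← eX] at hp ⊢
        exact Or.inl (Or.inl (Or.inl ⟨s, ⟨hpos s hs _ hp, hp⟩, rfl⟩))
      · rw [← eY] at hp ⊢
        exact Or.inl (Or.inl (Or.inr ⟨s, ⟨hpos s hs _ hp, hp⟩, rfl⟩))
      · rw [← eZ] at hp ⊢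
        exact Or.inl (Or.inr ⟨s, ⟨hpos s hs _ hp, hp⟩, rfl⟩)
      · rw [← eW] at hp ⊢
        exact Or.inr ⟨s, ⟨hpos s hs _ hp, hp⟩, rfl⟩
    · rintro (((⟨s, hs, rfl⟩ | ⟨s, hs, rfl⟩) | ⟨s, hs, rfl⟩) | ⟨s, hs, rfl⟩)
      · exact ⟨hs.2, Or.inl (Or.inl (Or.inl ⟨s, hs.1.le, eX s⟩))⟩
      · exact ⟨hs.2, Or.inl (Or.inl (Or.inr ⟨s, hs.1.le, eY s⟩))⟩
      · exact ⟨hs.2, Or.inl (Or.inr ⟨s, hs.1.le, eZ s⟩)⟩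
      · exact ⟨hs.2, Or.inr ⟨s, hs.1.le, eW s⟩⟩
  have hcard : (tropV g ∩ raysXYZW).encard = m := by
    rw [hset, Set.encard_union_eq, Set.encard_union_eq, Set.encard_union_eq,
      (rayPt_inj (by simp)).encard_image, (rayPt_inj (by simp)).encard_image,
      (rayPt_inj (by simp)).encard_image, (rayPt_inj (by simp)).encard_image, cX, cY, cZ, cW, ← hd]
    · push_cast; rfl
    · rw [Set.disjoint_left]
      rintro _ ⟨s, hs, rfl⟩ ⟨r, hr, h⟩
      have := hs.1
      simp [rayPt] at h
      linarith
    · rw [Set.disjoint_left]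
      rintro _ (⟨s, hs, rfl⟩ | ⟨s, hs, rfl⟩) ⟨r, hr, h⟩ <;>
      · have := hs.1
        simp [rayPt] at h
        linarith
    · rw [Set.disjoint_left]
      rintro _ ((⟨s, hs, rfl⟩ | ⟨s, hs, rfl⟩) | ⟨s, hs, rfl⟩) ⟨r, hr, h⟩ <;>
      · have := hs.1
        have := hr.1
        simp [rayPt] at h
        linarith
  refine ⟨Set.finite_of_encard_eq_coe hcard, ?_⟩
  rw [Set.ncard, hcard]
  simp
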